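/- Let A and Q be n×n complex matrices with Q symmetric (Qᵀ = Q), B an n×m complex matrix, and R an invertible symmetric m×m complex matrix, and let ℍ be the 2n×2n block matrix ℍ = [[A, −B R⁻¹ Bᵀ],[Q, Aᵀ]]. Call μ ∈ ℂ an eigenvalue of the bidirectional dynamics if there exist δx, δλ ∈ ℂⁿ, not both zero, such that ℍ·(δx, μ·δλ) = (μ·δx, δλ). If μ ≠ 0 is an eigenvalue of the bidirectional dynamics, then 1/μ is also an eigenvalue of the bidirectional dynamics, i.e., there exist ṽ, w̃ ∈ ℂⁿ, not both zero, with ℍ·(ṽ, (1/μ)·w̃) = ((1/μ)·ṽ, w̃). -/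

import Mathlib

open scoped Matrix

namespace BidirectionalDynamics

variable {ι K : Type*} [DecidableEq ι] [Field K]

/-- The symmetric part `[[Q, Aᵀ], [A, P]]` of the block matrix `[[A, P], [Q, Aᵀ]]`, shifted so that
its kernel consists of the pairs `(x, μ • l)` with `(x, l)` an eigenvector of the bidirectional
dynamics for `μ`. -/
def pencil (A P Q : Matrix ι ι K) (μ : K) : Matrix (ι ⊕ ι) (ι ⊕ ι) K :=
  Matrix.fromBlocks Q (Aᵀ - μ⁻¹ • 1) (A - μ • 1) P

theorem pencil_transpose {A P Q : Matrix ι ι K} (hP : Pᵀ = P) (hQ : Qᵀ = Q) (μ : K) :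
    (pencil A P Q μ)ᵀ = pencil A P Q μ⁻¹ := by
  simp [pencil, Matrix.fromBlocks_transpose, hP, hQ]

variable [Fintype ι]

theorem pencil_mulVec_eq_zero_iff (A P Q : Matrix ι ι K) {μ : K} (hμ : μ ≠ 0) (x l : ι → K) :
    pencil A P Q μ *ᵥ Sum.elim x (μ • l) = 0 ↔
      Matrix.fromBlocks A P Q Aᵀ *ᵥ Sum.elim x (μ • l) = Sum.elim (μ • x) l := by
  rw [pencil, Matrix.fromBlocks_mulVec, Matrix.fromBlocks_mulVec, ← Sum.elim_zero_zero,
    Sum.elim_eq_iff, Sum.elim_eq_iff, and_comm]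
  simp only [Sum.elim_comp_inl, Sum.elim_comp_inr, Matrix.sub_mulVec, Matrix.smul_mulVec,
    Matrix.one_mulVec, inv_smul_smul₀ hμ]
  rw [← sub_eq_zero (b := μ • x), ← sub_eq_zero (b := l), sub_add_eq_add_sub, add_sub_assoc (Q *ᵥ x)]

theorem exists_eigenvector_iff_det_pencil_eq_zero (A P Q : Matrix ι ι K) {μ : K} (hμ : μ ≠ 0) :
    (∃ x l : ι → K, ¬(x = 0 ∧ l = 0) ∧
      Matrix.fromBlocks A P Q Aᵀ *ᵥ Sum.elim x (μ • l) = Sum.elim (μ • x) l) ↔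
      (pencil A P Q μ).det = 0 := by
  have elim_eq_zero (x l : ι → K) : Sum.elim x (μ • l) = 0 ↔ x = 0 ∧ l = 0 := by
    rw [← Sum.elim_zero_zero, Sum.elim_eq_iff, smul_eq_zero_iff_right hμ]
  rw [← Matrix.exists_mulVec_eq_zero_iff]
  constructor
  · rintro ⟨x, l, hne, h⟩
    exact ⟨Sum.elim x (μ • l), mt (elim_eq_zero x l).1 hne,
      (pencil_mulVec_eq_zero_iff A P Q hμ x l).2 h⟩
  · rintro ⟨z, hz, h⟩
    have hsplit : Sum.elim (z ∘ Sum.inl) (μ • μ⁻¹ • (z ∘ Sum.inr)) = z := by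
      rw [smul_inv_smul₀ hμ, Sum.elim_comp_inl_inr]
    refine ⟨z ∘ Sum.inl, μ⁻¹ • (z ∘ Sum.inr), fun h0 => hz ?_, ?_⟩
    · rw [← hsplit, elim_eq_zero]
      exact h0
    · rw [← pencil_mulVec_eq_zero_iff A P Q hμ, hsplit, h]

end BidirectionalDynamics

/-- Eigenvalue symmetry of the bidirectional Hamiltonian dynamics: with
`ℍ = [[A, -BR⁻¹Bᵀ], [Q, Aᵀ]]`, `Q` and `R` symmetric and `R` invertible, if `μ ≠ 0`
satisfies `ℍ (δx, μ δλ) = (μ δx, δλ)` for some `(δx, δλ) ≠ (0, 0)`, then `1/μ` is also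
an eigenvalue of the bidirectional dynamics. -/
theorem bidirectional_eigenvalue_reciprocal {n m : ℕ}
    (A Q : Matrix (Fin n) (Fin n) ℂ) (hQ : Qᵀ = Q)
    (B : Matrix (Fin n) (Fin m) ℂ) (R : Matrix (Fin m) (Fin m) ℂ)
    (hR : IsUnit R) (hRsymm : Rᵀ = R)
    (μ : ℂ) (hμ : μ ≠ 0) (dx dl : Fin n → ℂ) (hne : ¬(dx = 0 ∧ dl = 0))
    (heig : (Matrix.fromBlocks A (-(B * R⁻¹ * Bᵀ)) Q Aᵀ).mulVec (Sum.elim dx (μ • dl))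
        = Sum.elim (μ • dx) dl) :
    ∃ v w : Fin n → ℂ, ¬(v = 0 ∧ w = 0) ∧
      (Matrix.fromBlocks A (-(B * R⁻¹ * Bᵀ)) Q Aᵀ).mulVec (Sum.elim v (μ⁻¹ • w))
        = Sum.elim (μ⁻¹ • v) w := by
  have hP : (-(B * R⁻¹ * Bᵀ))ᵀ = -(B * R⁻¹ * Bᵀ) := by
    simp [Matrix.transpose_mul, Matrix.transpose_nonsing_inv, hRsymm, Matrix.mul_assoc]
  rw [BidirectionalDynamics.exists_eigenvector_iff_det_pencil_eq_zero _ _ _ (inv_ne_zero hμ),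
    ← BidirectionalDynamics.pencil_transpose hP hQ, Matrix.det_transpose,
    ← BidirectionalDynamics.exists_eigenvector_iff_det_pencil_eq_zero _ _ _ hμ]
  exact ⟨dx, dl, hne, heig⟩
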